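/- Let Z be a 4×4 antisymmetric complex matrix and Z_I ∈ ℂ (I = 1,…,n), and let ξ_{ABI} (A,B ∈ {1,…,4}, I = 1,…,n) be complex numbers antisymmetric in A,B and satisfying the reality constraint conj(ξ_{ABI}) = (1/2) Σ_{C,D} ε^{ABCD} ξ_{CDI}. Define the O(6,n)-coset variations (δZ)_{AB} = Σ_I ξ_{ABI} · conj(Z_I) and (δZ)_I = (1/2) Σ_{A,B} ξ_{ABI} · conj(Z_{AB}). Then the complex quadratic invariant I₂ = (1/4) Σ ε^{ABCD} Z_{AB} Z_{CD} − Σ_I conj(Z_I)·conj(Z_I) is invariant to first order: d/dt I₂(Z + t·δZ, Z_I + t·(δZ)_I) |_{t=0} = 0 for real t. -/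

import Mathlib

open Matrix

/-- The totally antisymmetric Levi-Civita symbol on `n` indices, with
`ε^{1…n} = 1` (value on the identity arrangement) and vanishing on
non-injective index arrangements. -/
noncomputable def epsSign {n : ℕ} (v : Fin n → Fin n) : ℤ :=
  if h : Function.Bijective v then Equiv.Perm.sign (Equiv.ofBijective v h) else 0

/-- The Levi-Civita symbol `ε^{ABCD}` on 4 indices with `ε^{1234} = 1`. -/
noncomputable def eps4 (A B C D : Fin 4) : ℤ := epsSign ![A, B, C, D]

/-- The real quadratic `O(6,n)` invariant
`I₁ = (1/2) Σ_{A,B} Z_{AB} conj(Z_{AB}) − Σ_I Z_I conj(Z_I)` of `N = 4` supergravity. -/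
noncomputable def I₁ {n : ℕ} (Z : Matrix (Fin 4) (Fin 4) ℂ) (W : Fin n → ℂ) : ℝ :=
  ((1 / 2 : ℂ) * ∑ A, ∑ B, Z A B * (starRingEnd ℂ) (Z A B)
    - ∑ I, W I * (starRingEnd ℂ) (W I)).re

/-- The complex quadratic `O(6,n)` invariant
`I₂ = (1/4) Σ ε^{ABCD} Z_{AB} Z_{CD} − Σ_I conj(Z_I)²` of `N = 4` supergravity. -/
noncomputable def I₂ {n : ℕ} (Z : Matrix (Fin 4) (Fin 4) ℂ) (W : Fin n → ℂ) : ℂ :=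
  (1 / 4 : ℂ) * (∑ A, ∑ B, ∑ C, ∑ D, (eps4 A B C D : ℂ) * Z A B * Z C D)
    - ∑ I, (starRingEnd ℂ) (W I) * (starRingEnd ℂ) (W I)

theorem epsSign_comp_perm {n : ℕ} (v : Fin n → Fin n) (σ : Equiv.Perm (Fin n)) :
    epsSign (v ∘ σ) = Equiv.Perm.sign σ * epsSign v := by
  unfold epsSign
  by_cases h : Function.Bijective v
  · have h' : Function.Bijective (v ∘ σ) := h.comp σ.bijective
    have e : Equiv.ofBijective (v ∘ σ) h' = Equiv.ofBijective v h * σ := by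
      ext x
      simp
    rw [dif_pos h, dif_pos h', e, Equiv.Perm.sign_mul, Units.val_mul, mul_comm]
  · have h' : ¬ Function.Bijective (v ∘ σ) := by
      rwa [σ.bijective.of_comp_iff]
    rw [dif_neg h, dif_neg h', mul_zero]

theorem eps4_swap_pairs (A B C D : Fin 4) : eps4 C D A B = eps4 A B C D := by
  have h := epsSign_comp_perm ![A, B, C, D] (Equiv.swap 0 2 * Equiv.swap 1 3)
  have hv : ![A, B, C, D] ∘ (Equiv.swap 0 2 * Equiv.swap 1 3 : Equiv.Perm (Fin 4)) =
      ![C, D, A, B] := by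
    funext i
    fin_cases i <;> rfl
  have hs : Equiv.Perm.sign (Equiv.swap 0 2 * Equiv.swap 1 3 : Equiv.Perm (Fin 4)) = 1 := by
    decide
  rw [hv, hs] at h
  simpa [eps4] using h

theorem sum_eps4_mul_comm (X Z : Matrix (Fin 4) (Fin 4) ℂ) :
    ∑ A, ∑ B, ∑ C, ∑ D, (eps4 A B C D : ℂ) * X A B * Z C D =
      ∑ A, ∑ B, ∑ C, ∑ D, (eps4 A B C D : ℂ) * Z A B * X C D := by
  simp only [← Fintype.sum_prod_type'
    (f := fun C D => (eps4 _ _ C D : ℂ) * X _ _ * Z C D),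
    ← Fintype.sum_prod_type' (f := fun C D => (eps4 _ _ C D : ℂ) * Z _ _ * X C D)]
  rw [← Fintype.sum_prod_type'
      (f := fun A B => ∑ p : Fin 4 × Fin 4, (eps4 A B p.1 p.2 : ℂ) * X A B * Z p.1 p.2),
    ← Fintype.sum_prod_type'
      (f := fun A B => ∑ p : Fin 4 × Fin 4, (eps4 A B p.1 p.2 : ℂ) * Z A B * X p.1 p.2),
    Finset.sum_comm]
  refine Finset.sum_congr rfl fun p _ => Finset.sum_congr rfl fun q _ => ?_
  rw [eps4_swap_pairs p.1 p.2 q.1 q.2]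
  ring

/-- The first variation of `I₂` along an arbitrary direction `(X, V)`. -/
theorem hasDerivAt_I₂_line {n : ℕ} (Z X : Matrix (Fin 4) (Fin 4) ℂ) (W V : Fin n → ℂ) :
    HasDerivAt (fun t : ℝ => I₂ (Z + (t : ℂ) • X) (W + (t : ℂ) • V))
      ((1 / 2 : ℂ) * (∑ A, ∑ B, ∑ C, ∑ D, (eps4 A B C D : ℂ) * Z A B * X C D)
        - 2 * ∑ I, (starRingEnd ℂ) (W I) * (starRingEnd ℂ) (V I)) 0 := by
  have line (a b : ℂ) : HasDerivAt (fun t : ℝ => a + (t : ℂ) * b) b 0 := by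
    simpa using (((hasDerivAt_id (0 : ℝ)).ofReal_comp).mul_const b).const_add a
  have hquad (A B C D : Fin 4) : HasDerivAt
      (fun t : ℝ => (eps4 A B C D : ℂ) * (Z A B + (t : ℂ) * X A B) * (Z C D + (t : ℂ) * X C D))
      ((eps4 A B C D : ℂ) * X A B * Z C D + (eps4 A B C D : ℂ) * Z A B * X C D) 0 := by
    simpa using ((line (Z A B) (X A B)).const_mul (eps4 A B C D : ℂ)).fun_mul
      (line (Z C D) (X C D))
  have hmatter (I : Fin n) : HasDerivAt
      (fun t : ℝ => ((starRingEnd ℂ) (W I) + (t : ℂ) * (starRingEnd ℂ) (V I)) *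
        ((starRingEnd ℂ) (W I) + (t : ℂ) * (starRingEnd ℂ) (V I)))
      (2 * ((starRingEnd ℂ) (W I) * (starRingEnd ℂ) (V I))) 0 := by
    refine ((line ((starRingEnd ℂ) (W I)) ((starRingEnd ℂ) (V I))).fun_mul
      (line ((starRingEnd ℂ) (W I)) ((starRingEnd ℂ) (V I)))).congr_deriv ?_
    push_cast
    ring
  have h := ((HasDerivAt.fun_sum (u := Finset.univ) fun A _ =>
    HasDerivAt.fun_sum (u := Finset.univ) fun B _ =>
    HasDerivAt.fun_sum (u := Finset.univ) fun C _ =>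
    HasDerivAt.fun_sum (u := Finset.univ) fun D _ => hquad A B C D).const_mul (1 / 4 : ℂ)).fun_sub
    (HasDerivAt.fun_sum (u := Finset.univ) fun I _ => hmatter I)
  simp only [Finset.sum_add_distrib, ← Finset.mul_sum (f := fun I =>
    (starRingEnd ℂ) (W I) * (starRingEnd ℂ) (V I)), sum_eps4_mul_comm X Z] at h
  simp only [I₂, Matrix.add_apply, Matrix.smul_apply, Pi.add_apply, Pi.smul_apply, smul_eq_mul,
    map_add, map_mul, Complex.conj_ofReal]
  exact h.congr_deriv (by ring)

/-- For a 4×4 antisymmetric central-charge matrix `Z` and matter charges `Z_I`,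
the complex quadratic invariant `I₂` is invariant to first order under the
`O(6,n)/(O(6)×O(n))` coset variations
`(δZ)_{AB} = Σ_I ξ_{ABI} conj(Z_I)`, `(δZ)_I = (1/2) Σ_{A,B} ξ_{ABI} conj(Z_{AB})`,
where `ξ_{ABI}` is antisymmetric in `A,B` and satisfies the reality constraint
`conj(ξ_{ABI}) = (1/2) Σ ε^{ABCD} ξ_{CDI}`. -/
theorem I2_invariant_under_O6n_coset_variation {n : ℕ}
    (Z : Matrix (Fin 4) (Fin 4) ℂ) (hZ : Zᵀ = -Z) (W : Fin n → ℂ)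
    (ξm : Fin 4 → Fin 4 → Fin n → ℂ)
    (hanti : ∀ A B I, ξm B A I = -ξm A B I)
    (hreal : ∀ A B I, (starRingEnd ℂ) (ξm A B I) =
      (1 / 2 : ℂ) * ∑ C, ∑ D, (eps4 A B C D : ℂ) * ξm C D I) :
    deriv (fun t : ℝ =>
      I₂ (Z + (t : ℂ) • Matrix.of fun A B => ∑ I, ξm A B I * (starRingEnd ℂ) (W I))
        (W + (t : ℂ) • fun I =>
          (1 / 2 : ℂ) * ∑ A, ∑ B, ξm A B I * (starRingEnd ℂ) (Z A B))) 0 = 0 := by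
  refine (hasDerivAt_I₂_line Z _ W _).deriv.trans ?_
  have hdual (A B : Fin 4) :
      ∑ C, ∑ D, (eps4 A B C D : ℂ) * Z A B * ∑ I, ξm C D I * (starRingEnd ℂ) (W I) =
        2 * ∑ I, (starRingEnd ℂ) (W I) * ((starRingEnd ℂ) (ξm A B I) * Z A B) := by
    simp only [hreal, Finset.mul_sum, Finset.sum_mul,
      Finset.sum_comm (s := (Finset.univ : Finset (Fin 4))) (t := (Finset.univ : Finset (Fin n)))]
    refine Finset.sum_congr rfl fun I _ => Finset.sum_congr rfl fun C _ =>
      Finset.sum_congr rfl fun D _ => ?_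
    ring
  simp only [Matrix.of_apply, hdual, map_mul, map_sum, Complex.conj_conj]
  simp only [Finset.mul_sum,
    Finset.sum_comm (s := (Finset.univ : Finset (Fin 4))) (t := (Finset.univ : Finset (Fin n)))]
  rw [sub_eq_zero]
  refine Finset.sum_congr rfl fun I _ => Finset.sum_congr rfl fun A _ =>
    Finset.sum_congr rfl fun B _ => ?_
  simp only [map_div₀, map_one, map_ofNat]
  ring
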